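/- Suppose the ADMM iterates (x^k, λ^k)_{k∈ℕ} satisfy, for every k, the first-order optimality condition ∇f(x^{k+1}) + Aᵀλ^k + Aᵀρ^k A x^k + Q̄(x^{k+1} − x^k) = 0 and the multiplier update λ^{k+1} = λ^k + ρ^{k+1} A x^{k+1}; suppose Condition A holds (ρ^0 ⪯ ρ^k ⪯ ρ^{k+1} ⪯ ρ̄ for all k, with all ρ^k and ρ̄ diagonal positive definite), Condition B holds (Q̄ − Aᵀρ̄A is positive definite), and the Lagrangian L has a saddle point (x*, λ*). Then for every k ∈ ℕ: ‖λ^{k+1} − λ*‖²_{(ρ^{k+1})^{-1}} + ‖x^{k+1} − x*‖²_{Q̄ − Aᵀρ^{k+1}A} + Σ_{i=0}^{k} (‖A x^{i+1}‖²_{ρ^i} + ‖x^{i+1} − x^i‖²_{Q̄ − Aᵀρ^i A}) ≤ ‖λ^0 − λ*‖²_{(ρ^0)^{-1}} + ‖x^0 − x*‖²_{Q̄}. -/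

import Mathlib

open Matrix

/-- The weighted squared (semi-)norm `‖v‖²_M = vᵀ M v`. -/
noncomputable def msq {ι : Type*} [Fintype ι] (M : Matrix ι ι ℝ) (v : ι → ℝ) : ℝ :=
  v ⬝ᵥ (M *ᵥ v)

theorem msq_sub_left {ι : Type*} [Fintype ι] (M P : Matrix ι ι ℝ) (v : ι → ℝ) :
    msq (M - P) v = msq M v - msq P v := by
  simp only [msq, sub_mulVec, dotProduct_sub]

theorem msq_transpose_mul_mul {ι κ : Type*} [Fintype ι] [Fintype κ] (R : Matrix κ κ ℝ)
    (A : Matrix κ ι ℝ) (v : ι → ℝ) : msq (Aᵀ * R * A) v = msq R (A *ᵥ v) := by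
  simp only [msq, ← mulVec_mulVec]
  rw [dotProduct_mulVec, vecMul_transpose]

theorem Matrix.IsSymm.dotProduct_mulVec_comm {ι : Type*} [Fintype ι] {M : Matrix ι ι ℝ}
    (hM : M.IsSymm) (u v : ι → ℝ) : u ⬝ᵥ (M *ᵥ v) = v ⬝ᵥ (M *ᵥ u) := by
  rw [dotProduct_mulVec, ← mulVec_transpose, hM.eq, dotProduct_comm]

theorem Matrix.IsSymm.msq_add {ι : Type*} [Fintype ι] {M : Matrix ι ι ℝ} (hM : M.IsSymm)
    (u v : ι → ℝ) : msq M (u + v) = msq M u + 2 * (u ⬝ᵥ (M *ᵥ v)) + msq M v := by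
  simp only [msq, mulVec_add, dotProduct_add, add_dotProduct]
  rw [hM.dotProduct_mulVec_comm v u]
  ring

theorem Matrix.IsSymm.msq_sub {ι : Type*} [Fintype ι] {M : Matrix ι ι ℝ} (hM : M.IsSymm)
    (u v : ι → ℝ) : msq M (u - v) = msq M u - 2 * (u ⬝ᵥ (M *ᵥ v)) + msq M v := by
  simp only [msq, mulVec_sub, dotProduct_sub, sub_dotProduct]
  rw [hM.dotProduct_mulVec_comm v u]
  ring

theorem Matrix.PosSemidef.msq_nonneg {ι : Type*} [Fintype ι] {M : Matrix ι ι ℝ}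
    (hM : M.PosSemidef) (v : ι → ℝ) : 0 ≤ msq M v := by
  simpa [msq] using hM.dotProduct_mulVec_nonneg v

theorem Matrix.PosSemidef.isSymm {ι : Type*} [Fintype ι] {M : Matrix ι ι ℝ}
    (hM : M.PosSemidef) : M.IsSymm := by
  simpa [IsHermitian, IsSymm] using hM.isHermitian

theorem Matrix.PosDef.mulVec_inv_mulVec {ι : Type*} [Fintype ι] [DecidableEq ι]
    {M : Matrix ι ι ℝ} (hM : M.PosDef) (v : ι → ℝ) : M *ᵥ (M⁻¹ *ᵥ v) = v := by
  rw [mulVec_mulVec, mul_nonsing_inv _ ((isUnit_iff_isUnit_det _).mp hM.isUnit), one_mulVec]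

theorem Matrix.PosDef.inv_mulVec_mulVec {ι : Type*} [Fintype ι] [DecidableEq ι]
    {M : Matrix ι ι ℝ} (hM : M.PosDef) (v : ι → ℝ) : M⁻¹ *ᵥ (M *ᵥ v) = v := by
  rw [mulVec_mulVec, nonsing_inv_mul _ ((isUnit_iff_isUnit_det _).mp hM.isUnit), one_mulVec]

/-- Inversion of positive definite matrices is antitone for the Loewner order. -/
theorem msq_inv_le_msq_inv {ι : Type*} [Fintype ι] [DecidableEq ι] {S R : Matrix ι ι ℝ}
    (hS : S.PosDef) (hR : R.PosDef) (hSR : (R - S).PosSemidef) (v : ι → ℝ) :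
    msq R⁻¹ v ≤ msq S⁻¹ v := by
  have hsq := hS.posSemidef.msq_nonneg (R⁻¹ *ᵥ v - S⁻¹ *ᵥ v)
  have hmono := hSR.msq_nonneg (R⁻¹ *ᵥ v)
  rw [hS.posSemidef.isSymm.msq_sub, hS.mulVec_inv_mulVec] at hsq
  rw [msq_sub_left] at hmono
  simp only [msq, hS.mulVec_inv_mulVec, hR.mulVec_inv_mulVec] at hsq hmono ⊢
  rw [dotProduct_comm v, dotProduct_comm v]
  linarith

theorem ConvexOn.add_fderiv_sub_le {V : Type*} [NormedAddCommGroup V] [NormedSpace ℝ V]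
    {f : V → ℝ} (hf : ConvexOn ℝ Set.univ f) {x : V} (hx : DifferentiableAt ℝ f x) (y : V) :
    f x + fderiv ℝ f x (y - x) ≤ f y := by
  have hline : HasDerivAt (AffineMap.lineMap x y : ℝ → V) (y - x) 0 :=
    AffineMap.hasDerivAt_lineMap
  have hderiv : HasDerivAt (f ∘ (AffineMap.lineMap x y : ℝ →ᵃ[ℝ] V))
      (fderiv ℝ f x (y - x)) 0 := by
    refine HasFDerivAt.comp_hasDerivAt 0 ?_ hline
    simpa using hx.hasFDerivAt
  have hconv := hf.comp_affineMap (AffineMap.lineMap x y : ℝ →ᵃ[ℝ] V)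
  have h := hconv.le_slope_of_hasDerivAt (Set.mem_univ 0) (Set.mem_univ 1) one_pos hderiv
  simp only [slope_def_field, Function.comp_apply, AffineMap.lineMap_apply_zero,
    AffineMap.lineMap_apply_one, sub_zero, div_one] at h
  linarith

/-- The energy decrease of one ADMM step relative to a reference point in the kernel of the
constraint matrix, where `g` is the gradient of the objective at the new primal iterate. -/
theorem admm_step_estimate {ι κ : Type*} [Fintype ι] [Fintype κ] [DecidableEq κ]
    {A : Matrix κ ι ℝ} {Q : Matrix ι ι ℝ} {R R' : Matrix κ κ ℝ} {x x' xs g : ι → ℝ}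
    {l l' ls : κ → ℝ} (hQ : Q.IsSymm) (hR : R.PosDef) (hR' : R'.PosDef)
    (hRR' : (R' - R).PosSemidef) (hxs : A *ᵥ xs = 0)
    (hopt : g + Aᵀ *ᵥ l + Aᵀ *ᵥ (R *ᵥ (A *ᵥ x)) + Q *ᵥ (x' - x) = 0)
    (hlam : l' = l + R' *ᵥ (A *ᵥ x')) (hg : 0 ≤ g ⬝ᵥ (x' - xs) + ls ⬝ᵥ (A *ᵥ x')) :
    msq R'⁻¹ (l' - ls) + msq (Q - Aᵀ * R' * A) (x' - xs)
        + (msq R (A *ᵥ x') + msq (Q - Aᵀ * R * A) (x' - x))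
      ≤ msq R⁻¹ (l - ls) + msq (Q - Aᵀ * R * A) (x - xs) := by
  have hA (y : ι → ℝ) : A *ᵥ (y - xs) = A *ᵥ y := by rw [mulVec_sub, hxs, sub_zero]
  have hinv := msq_inv_le_msq_inv hR hR' hRR' (l - ls)
  have hdual : msq R'⁻¹ (l' - ls) =
      msq R'⁻¹ (l - ls) + 2 * ((l - ls) ⬝ᵥ (A *ᵥ x')) + msq R' (A *ᵥ x') := by
    have hl : l' - ls = (l - ls) + R' *ᵥ (A *ᵥ x') := by rw [hlam]; abel
    rw [hl, hR'.inv.posSemidef.isSymm.msq_add, hR'.inv_mulVec_mulVec]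
    congr 1
    simp only [msq, hR'.inv_mulVec_mulVec]
    exact dotProduct_comm _ _
  have hprimal : msq Q (x - xs) =
      msq Q (x' - xs) - 2 * ((x' - xs) ⬝ᵥ (Q *ᵥ (x' - x))) + msq Q (x' - x) := by
    rw [← hQ.msq_sub]
    congr 1
    abel
  have hpen : msq R (A *ᵥ x' - A *ᵥ x) =
      msq R (A *ᵥ x') - 2 * ((A *ᵥ x') ⬝ᵥ (R *ᵥ (A *ᵥ x))) + msq R (A *ᵥ x) :=
    hR.posSemidef.isSymm.msq_sub _ _
  have hT (w : κ → ℝ) : (x' - xs) ⬝ᵥ (Aᵀ *ᵥ w) = (A *ᵥ x') ⬝ᵥ w := by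
    rw [dotProduct_mulVec, vecMul_transpose, hA]
  have hstat := congrArg ((x' - xs) ⬝ᵥ ·) hopt
  simp only [dotProduct_add, hT, dotProduct_zero] at hstat
  rw [dotProduct_comm _ g, dotProduct_comm _ l] at hstat
  simp only [msq_sub_left, msq_transpose_mul_mul, hA, mulVec_sub A x' x]
  rw [sub_dotProduct] at hdual
  linarith

/-- the cumulative (telescoped) contraction estimate for the ADMM
iterates under Conditions A and B. -/
theorem admm_cumulative_estimate
    (N D E : ℕ) (hN : 0 < N) (hD : 0 < D) (hE : 0 < E)
    (f : (Fin (N * D) → ℝ) → ℝ) (gf : (Fin (N * D) → ℝ) → (Fin (N * D) → ℝ))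
    (hconv : ConvexOn ℝ Set.univ f) (hsmooth : ContDiff ℝ 1 f)
    (hgrad : ∀ x v, fderiv ℝ f x v = gf x ⬝ᵥ v)
    (A : Matrix (Fin (E * D)) (Fin (N * D)) ℝ)
    (x : ℕ → (Fin (N * D) → ℝ)) (l : ℕ → (Fin (E * D) → ℝ))
    (ρ : ℕ → Matrix (Fin (E * D)) (Fin (E * D)) ℝ)
    (ρbar : Matrix (Fin (E * D)) (Fin (E * D)) ℝ)
    (Q : Matrix (Fin (N * D)) (Fin (N * D)) ℝ) (hQ : Q.IsSymm)
    -- iterates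
    (hopt : ∀ k, gf (x (k + 1)) + Aᵀ *ᵥ (l k) + Aᵀ *ᵥ (ρ k *ᵥ (A *ᵥ x k))
      + Q *ᵥ (x (k + 1) - x k) = 0)
    (hlam : ∀ k, l (k + 1) = l k + ρ (k + 1) *ᵥ (A *ᵥ x (k + 1)))
    -- Condition A
    (hρdiag : ∀ k, (ρ k).IsDiag) (hρpos : ∀ k, (ρ k).PosDef)
    (hρbardiag : ρbar.IsDiag) (hρbarpos : ρbar.PosDef)
    (hρmono : ∀ k, (ρ (k + 1) - ρ k).PosSemidef)
    (hρ0 : ∀ k, (ρ k - ρ 0).PosSemidef)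
    (hρbar : ∀ k, (ρbar - ρ k).PosSemidef)
    -- Condition B
    (hB : (Q - Aᵀ * ρbar * A).PosDef)
    -- saddle point
    (xs : Fin (N * D) → ℝ) (ls : Fin (E * D) → ℝ)
    (hsaddle : ∀ (y : Fin (N * D) → ℝ) (μ : Fin (E * D) → ℝ),
      f xs + μ ⬝ᵥ (A *ᵥ xs) ≤ f xs + ls ⬝ᵥ (A *ᵥ xs) ∧
      f xs + ls ⬝ᵥ (A *ᵥ xs) ≤ f y + ls ⬝ᵥ (A *ᵥ y)) :
    ∀ k : ℕ,
      msq (ρ (k + 1))⁻¹ (l (k + 1) - ls) + msq (Q - Aᵀ * ρ (k + 1) * A) (x (k + 1) - xs)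
        + ∑ i ∈ Finset.range (k + 1),
            (msq (ρ i) (A *ᵥ x (i + 1)) + msq (Q - Aᵀ * ρ i * A) (x (i + 1) - x i))
      ≤ msq (ρ 0)⁻¹ (l 0 - ls) + msq Q (x 0 - xs) := by
  have hxs : A *ᵥ xs = 0 := by
    have h := (hsaddle xs (ls + A *ᵥ xs)).1
    rw [add_dotProduct] at h
    exact dotProduct_self_eq_zero.mp
      (le_antisymm (by linarith) (by simpa using dotProduct_star_self_nonneg (A *ᵥ xs)))
  have hg (k : ℕ) : 0 ≤ gf (x (k + 1)) ⬝ᵥ (x (k + 1) - xs) + ls ⬝ᵥ (A *ᵥ x (k + 1)) := by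
    have hgradient := hconv.add_fderiv_sub_le
      (hsmooth.differentiable one_ne_zero (x (k + 1))) xs
    have hmin := (hsaddle (x (k + 1)) ls).2
    rw [hgrad, dotProduct_sub] at hgradient
    rw [hxs, dotProduct_zero] at hmin
    rw [dotProduct_sub]
    linarith
  have hstep (k : ℕ) := admm_step_estimate hQ (hρpos k) (hρpos (k + 1)) (hρmono k) hxs
    (hopt k) (hlam k) (hg k)
  intro k
  induction k with
  | zero =>
    have h := hstep 0
    have hnonneg := (hρpos 0).posSemidef.msq_nonneg (A *ᵥ (x 0 - xs))
    rw [msq_sub_left Q (Aᵀ * ρ 0 * A) (x 0 - xs), msq_transpose_mul_mul] at h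
    rw [Finset.sum_range_one]
    linarith
  | succ k ih =>
    rw [Finset.sum_range_succ]
    linarith [hstep (k + 1)]
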